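/- arXiv:astro-ph/0412045 — 5 statements merged into one kernel-verified Lean document; each statement's English description precedes it below -/
import Mathlib

section
/- Let x, y, x̃, ỹ, h, h̃, S be real numbers with S ≠ 0 and S + h̃ − h ≠ 0, and let hx, hy be real numbers. Consider the vectors in ℝ³: I = (0, 0, 1), N = (−hx, −hy, 1), and R = ((x̃ − x)/S, (ỹ − y)/S, (h̃ − h)/S). If I × N = −(R × N) (equality of cross products), then hx = (x − x̃)/(S + h̃ − h) and hy = (y − ỹ)/(S + h̃ − h). -/
open Matrix

/-- Law of reflection at the first mirror. If the incidence vector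
`I = (0,0,1)`, the surface normal `N = (-hx, -hy, 1)` and the reflection vector
`R = ((xt-x)/S, (yt-y)/S, (ht-h)/S)` satisfy `I ×₃ N = -(R ×₃ N)`, then
`hx = (x - xt)/(S + ht - h)` and `hy = (y - yt)/(S + ht - h)`.
(Here `xt, yt, ht` denote x̃, ỹ, h̃.) -/
theorem stmt0 (x y xt yt h ht S hx hy : ℝ) (hS : S ≠ 0) (hP : S + ht - h ≠ 0)
    (hrefl : crossProduct ![(0 : ℝ), 0, 1] ![-hx, -hy, 1]
        = -(crossProduct ![(xt - x) / S, (yt - y) / S, (ht - h) / S] ![-hx, -hy, 1])) :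
    hx = (x - xt) / (S + ht - h) ∧ hy = (y - yt) / (S + ht - h) := by
  have h0 := congrFun hrefl 0
  have h1 := congrFun hrefl 1
  simp [cross_apply] at h0 h1
  field_simp at h0 h1
  rw [eq_div_iff hP, eq_div_iff hP]
  constructor <;> linarith
end

section
/- Let Ω ⊆ ℝ² be open, let T = (x̃, ỹ) : Ω → ℝ² be differentiable, let h : Ω → ℝ and h̃ : ℝ² → ℝ be differentiable, and define S(x,y) = √((x̃(x,y) − x)² + (ỹ(x,y) − y)² + (h̃(T(x,y)) − h(x,y))²). Assume for every (x,y) ∈ Ω: S(x,y) > 0, S(x,y) + h̃(T(x,y)) − h(x,y) ≠ 0, the partial derivatives of h satisfy h_x(x,y) = (x − x̃(x,y))/(S(x,y) + h̃(T(x,y)) − h(x,y)) and h_y(x,y) = (y − ỹ(x,y))/(S(x,y) + h̃(T(x,y)) − h(x,y)), and the partial derivatives of h̃ at T(x,y) satisfy h̃_x̃(T(x,y)) = h_x(x,y) and h̃_ỹ(T(x,y)) = h_y(x,y). Then the function (x,y) ↦ S(x,y) + h̃(T(x,y)) − h(x,y) has vanishing gradient on Ω; in particular, if Ω is connected it is a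 constant P₀ on Ω. -/
open Set

/-- A real linear functional on the plane is determined by its values on the standard basis. -/
theorem clm_prod_apply (L : ℝ × ℝ →L[ℝ] ℝ) (v : ℝ × ℝ) :
    L v = v.1 * L (1, 0) + v.2 * L (0, 1) := by
  conv_lhs => rw [show v = v.1 • ((1, 0) : ℝ × ℝ) + v.2 • ((0, 1) : ℝ × ℝ) by ext <;> simp]
  simp only [map_add, map_smul, smul_eq_mul]

/-- Lemma 1: the optical path length `S + h̃∘T - h` of an on-axis ray
through a two-mirror pupil-mapping system has vanishing gradient on the open set Ω;
in particular it is constant if Ω is connected.  Here `T = (x̃, ỹ)` is the ray mapping,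
`h` is the first mirror surface, `ht` (= h̃) the second mirror surface, and
`S` the distance between corresponding mirror points. -/
theorem stmt1 (Ω : Set (ℝ × ℝ)) (hΩ : IsOpen Ω)
    (T : ℝ × ℝ → ℝ × ℝ) (h : ℝ × ℝ → ℝ) (ht : ℝ × ℝ → ℝ)
    (hTdiff : ∀ p ∈ Ω, DifferentiableAt ℝ T p)
    (hhdiff : ∀ p ∈ Ω, DifferentiableAt ℝ h p)
    (hhtdiff : Differentiable ℝ ht)
    (S : ℝ × ℝ → ℝ)
    (hSdef : ∀ p, S p =
      Real.sqrt (((T p).1 - p.1) ^ 2 + ((T p).2 - p.2) ^ 2 + (ht (T p) - h p) ^ 2))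
    (hSpos : ∀ p ∈ Ω, 0 < S p)
    (hPne : ∀ p ∈ Ω, S p + ht (T p) - h p ≠ 0)
    (hhx : ∀ p ∈ Ω, fderiv ℝ h p (1, 0) = (p.1 - (T p).1) / (S p + ht (T p) - h p))
    (hhy : ∀ p ∈ Ω, fderiv ℝ h p (0, 1) = (p.2 - (T p).2) / (S p + ht (T p) - h p))
    (hhtx : ∀ p ∈ Ω, fderiv ℝ ht (T p) (1, 0) = fderiv ℝ h p (1, 0))
    (hhty : ∀ p ∈ Ω, fderiv ℝ ht (T p) (0, 1) = fderiv ℝ h p (0, 1)) :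
    (∀ p ∈ Ω, fderiv ℝ (fun q => S q + ht (T q) - h q) p = 0) ∧
    (IsConnected Ω → ∃ P₀ : ℝ, ∀ p ∈ Ω, S p + ht (T p) - h p = P₀) := by
  have key : ∀ p ∈ Ω, HasFDerivAt (fun q => S q + ht (T q) - h q) (0 : ℝ × ℝ →L[ℝ] ℝ) p := by
    intro p hp
    have hT := (hTdiff p hp).hasFDerivAt
    have hh := (hhdiff p hp).hasFDerivAt
    have hhtT := (hhtdiff (T p)).hasFDerivAt.comp p hT
    have hA := hT.fst.sub (hasFDerivAt_id p).fst
    have hB := hT.snd.sub (hasFDerivAt_id p).snd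
    have hD := hhtT.sub hh
    have hrad : 0 < ((T p).1 - p.1) ^ 2 + ((T p).2 - p.2) ^ 2 + (ht (T p) - h p) ^ 2 := by
      have := hSpos p hp
      rwa [hSdef p, Real.sqrt_pos] at this
    have hS := (((hA.pow 2).add (hB.pow 2)).add (hD.pow 2)).sqrt hrad.ne'
    have hP := (hS.add hhtT).sub hh
    have hfun : (fun q => S q + ht (T q) - h q) = fun q => Real.sqrt (((T q).1 - q.1) ^ 2 +
        ((T q).2 - q.2) ^ 2 + (ht (T q) - h q) ^ 2) + ht (T q) - h q := by
      funext q
      rw [hSdef q]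
    rw [hfun]
    refine hP.congr_fderiv ?_
    refine ContinuousLinearMap.ext fun v => ?_
    have hS0 := (hSpos p hp).ne'
    have hP0 := hPne p hp
    have hsqrt := (hSdef p).symm
    have e1 := clm_prod_apply (fderiv ℝ h p) v
    have e2 := clm_prod_apply (fderiv ℝ ht (T p)) (fderiv ℝ T p v)
    rw [hhtx p hp, hhty p hp, hhx p hp, hhy p hp] at e2
    rw [hhx p hp, hhy p hp] at e1
    simp [hsqrt, e1, e2]
    field_simp
    ring
  refine ⟨fun p hp => (key p hp).fderiv, fun hc => ?_⟩
  exact hΩ.exists_is_const_of_fderiv_eq_zero hc.isPreconnected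
    (fun p hp => (key p hp).differentiableAt.differentiableWithinAt)
    (fun p hp => (key p hp).fderiv)
end

section
/- Let α, P₀, δ be real numbers with α ≠ 0 and P₀ ≠ 0. Define H̃(r̃, θ) = −(1 − α) r̃²/(2P₀) − δ r̃ cos θ / P₀ + P₀/2 − δ²/(2P₀) and H(r, θ) = (1 − 1/α) r²/(2P₀) − r δ cos θ / P₀. Then for all r̃, θ: ∂H̃/∂r̃ (r̃, θ) = (α r̃ − r̃ − δ cos θ)/P₀ and ∂H̃/∂θ (r̃, θ) = δ r̃ sin θ / P₀; moreover, for all r, θ, with r̃ = r/α one has H̃(r̃, θ) − H(r, θ) = P₀/2 − ((r̃ − r)² + 2(r̃ − r) δ cos θ + δ²)/(2P₀). -/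
/-- Section 5.1: for the constant amplitude mapping `A ≡ α` (so
`r = R(r̃) = α r̃`), the paraboloidal surfaces
`H̃(r̃,θ) = -(1-α) r̃²/(2P₀) - δ r̃ cos θ/P₀ + P₀/2 - δ²/(2P₀)` and
`H(r,θ) = (1 - 1/α) r²/(2P₀) - r δ cos θ/P₀` satisfy the differential equations
`H̃_r̃ = (α r̃ - r̃ - δ cos θ)/P₀`, `H̃_θ = δ r̃ sin θ/P₀`, and the constant-path
relation `H̃ - H = P₀/2 - ((r̃-r)² + 2(r̃-r) δ cos θ + δ²)/(2P₀)` with `r̃ = r/α`.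
(`Ht` denotes H̃, `rt` denotes r̃.) -/
theorem stmt5 (α P₀ δ : ℝ) (hα : α ≠ 0) (hP : P₀ ≠ 0)
    (Ht H : ℝ → ℝ → ℝ)
    (hHt : ∀ rt θ, Ht rt θ =
      -(1 - α) * rt ^ 2 / (2 * P₀) - δ * rt * Real.cos θ / P₀ + P₀ / 2 - δ ^ 2 / (2 * P₀))
    (hH : ∀ r θ, H r θ = (1 - 1 / α) * r ^ 2 / (2 * P₀) - r * δ * Real.cos θ / P₀) :
    (∀ rt θ : ℝ,
      deriv (fun s => Ht s θ) rt = (α * rt - rt - δ * Real.cos θ) / P₀ ∧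
      deriv (fun t => Ht rt t) θ = δ * rt * Real.sin θ / P₀) ∧
    (∀ r θ : ℝ,
      Ht (r / α) θ - H r θ =
        P₀ / 2 - ((r / α - r) ^ 2 + 2 * (r / α - r) * δ * Real.cos θ + δ ^ 2) / (2 * P₀)) := by
  refine ⟨fun rt θ => ⟨?_, ?_⟩, fun r θ => ?_⟩
  · simp only [hHt]
    have h := ((((((hasDerivAt_id rt).pow 2).const_mul (-(1 - α))).div_const (2 * P₀)).sub
      ((((hasDerivAt_id rt).const_mul δ).mul_const (Real.cos θ)).div_const P₀)).add_const
      (P₀ / 2)).sub_const (δ ^ 2 / (2 * P₀))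
    refine h.deriv.trans ?_
    simp only [id]
    field_simp
    push_cast
    ring
  · simp only [hHt]
    have h := ((((Real.hasDerivAt_cos θ).const_mul (δ * rt)).div_const P₀).const_sub
      (-(1 - α) * rt ^ 2 / (2 * P₀))).add_const (P₀ / 2) |>.sub_const (δ ^ 2 / (2 * P₀))
    refine h.deriv.trans ?_
    ring
  · rw [hHt, hH]
    field_simp
    ring
end

section
/- Let I ⊆ ℝ be an open interval, n > 0, let R̃ : I → ℝ, h : I → ℝ be differentiable, let h̃ : ℝ → ℝ be differentiable, and define S(r) = √((R̃(r) − r)² + (h̃(R̃(r)) − h(r))²). Assume for every r ∈ I: S(r) > 0, n·S(r) + h̃(R̃(r)) − h(r) ≠ 0, h′(r) = (r − R̃(r))/(n·S(r) + h̃(R̃(r)) − h(r)), and h̃′(R̃(r)) = h′(r). Then the function r ↦ (1/n)·S(r) + h̃(R̃(r)) − h(r) has zero derivative on I, and hence is constant on I. -/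
open Set

/-- Lemma 4: for a two-lens pupil-mapping system with refractive
index `n`, lens surfaces `z = h(r)`, `z̃ = ht(r̃)`, radial ray mapping `r̃ = Rt(r)`
(Rt = R̃), and distance `S(r)` between corresponding lens points, the reduced
optical path `Q₀ = S/n + h̃ - h` has zero derivative on the open interval `(a,b)`,
hence is constant there. -/
theorem stmt8 (a b : ℝ) (n : ℝ) (hn : 0 < n)
    (Rt h : ℝ → ℝ) (ht : ℝ → ℝ)
    (hRtdiff : ∀ r ∈ Ioo a b, DifferentiableAt ℝ Rt r)
    (hhdiff : ∀ r ∈ Ioo a b, DifferentiableAt ℝ h r)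
    (hhtdiff : Differentiable ℝ ht)
    (S : ℝ → ℝ)
    (hSdef : ∀ r, S r = Real.sqrt ((Rt r - r) ^ 2 + (ht (Rt r) - h r) ^ 2))
    (hSpos : ∀ r ∈ Ioo a b, 0 < S r)
    (hQne : ∀ r ∈ Ioo a b, n * S r + ht (Rt r) - h r ≠ 0)
    (hsnell : ∀ r ∈ Ioo a b, deriv h r = (r - Rt r) / (n * S r + ht (Rt r) - h r))
    (hpar : ∀ r ∈ Ioo a b, deriv ht (Rt r) = deriv h r) :
    (∀ r ∈ Ioo a b, deriv (fun t => (1 / n) * S t + ht (Rt t) - h t) r = 0) ∧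
    ∃ Q₀ : ℝ, ∀ r ∈ Ioo a b, (1 / n) * S r + ht (Rt r) - h r = Q₀ := by
  have key : ∀ r ∈ Ioo a b,
      HasDerivAt (fun t => (1 / n) * S t + ht (Rt t) - h t) 0 r := by
    intro r hr
    have hR := (hRtdiff r hr).hasDerivAt
    have hh := (hhdiff r hr).hasDerivAt
    have hD : HasDerivAt (fun t => ht (Rt t) - h t)
        (deriv h r * deriv Rt r - deriv h r) r := by
      have hcomp := (hhtdiff (Rt r)).hasDerivAt.comp r hR
      rw [hpar r hr] at hcomp
      exact hcomp.sub hh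
    have hpos := hSpos r hr
    have harg : (Rt r - r) ^ 2 + (ht (Rt r) - h r) ^ 2 ≠ 0 := by
      intro h0
      rw [hSdef r, h0, Real.sqrt_zero] at hpos
      exact hpos.false
    have hsn : deriv h r * (n * S r + ht (Rt r) - h r) = r - Rt r := by
      rw [hsnell r hr, div_mul_cancel₀ _ (hQne r hr)]
    have hS : HasDerivAt S (-(n * (deriv h r * deriv Rt r - deriv h r))) r := by
      rw [show S = fun t => √((Rt t - t) ^ 2 + (ht (Rt t) - h t) ^ 2) from funext hSdef]
      refine (((hR.fun_sub (hasDerivAt_id' r)).fun_pow 2).fun_add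
        (hD.fun_pow 2)).sqrt harg |>.congr_deriv ?_
      rw [← hSdef r, div_eq_iff (by positivity)]
      push_cast
      linear_combination 2 * (deriv Rt r - 1) * hsn
    simp only [add_sub_assoc]
    refine ((hS.const_mul (1 / n)).fun_add hD).congr_deriv ?_
    field_simp
    ring
  refine ⟨fun r hr => (key r hr).deriv, ?_⟩
  obtain ⟨Q₀, hQ₀⟩ := isOpen_Ioo.exists_is_const_of_deriv_eq_zero isPreconnected_Ioo
    (fun r hr => (key r hr).differentiableAt.differentiableWithinAt)
    (fun r hr => (key r hr).deriv)
  exact ⟨Q₀, hQ₀⟩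
end

section
/- Let n > 1, and let r, r̃, h, h̃, S, Q₀ be real numbers satisfying: S = √((r̃ − r)² + (h̃ − h)²) > 0, h̃ − h ≥ 0, Q₀ = S/n + h̃ − h, and let h′ = (r − r̃)/(n·S + h̃ − h). Then h′ = (r − r̃)/√(n² Q₀² + (n² − 1)(r − r̃)²). -/
/-- Theorem 2: for a two-lens pupil-mapping system with refractive
index `n`, if `S = √((r̃-r)² + (h̃-h)²) > 0`, `h̃ - h ≥ 0`, `Q₀ = S/n + h̃ - h`, and
the slope given by Snell's law is `h' = (r - r̃)/(n S + h̃ - h)`, then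
`h' = (r - r̃)/√(n² Q₀² + (n² - 1)(r - r̃)²)`.  (`rt, ht'` denote r̃, h̃.) -/
theorem stmt11 (n r rt h ht' S Q₀ h' : ℝ) (hn : 1 < n)
    (hSdef : S = Real.sqrt ((rt - r) ^ 2 + (ht' - h) ^ 2)) (hSpos : 0 < S)
    (hhd : 0 ≤ ht' - h)
    (hQ : Q₀ = S / n + (ht' - h))
    (hh' : h' = (r - rt) / (n * S + ht' - h)) :
    h' = (r - rt) / Real.sqrt (n ^ 2 * Q₀ ^ 2 + (n ^ 2 - 1) * (r - rt) ^ 2) := by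
  have hn0 : n ≠ 0 := by positivity
  have hS2 : S ^ 2 = (rt - r) ^ 2 + (ht' - h) ^ 2 := by
    rw [hSdef, Real.sq_sqrt (by positivity)]
  have hnQ : n * Q₀ = S + n * (ht' - h) := by
    rw [hQ]
    field_simp
  have hsq : n ^ 2 * Q₀ ^ 2 + (n ^ 2 - 1) * (r - rt) ^ 2 = (n * S + ht' - h) ^ 2 := by
    rw [← mul_pow, hnQ]
    linear_combination (1 - n ^ 2) * hS2
  have hnS : 0 < n * S := by positivity
  rw [hh', hsq, Real.sqrt_sq (by linarith)]
end
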